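/- arXiv:2306.13527 — 3 statements merged into one kernel-verified Lean document; each statement's English description precedes it below -/
import Mathlib

section
/- Let s>0, n≥1, 0<δ≤1, and let f∈B^n_s satisfy condition (P1+) with parameter δ. Then for every k∈G^n with |k|_1 ≥ N(δ), the Fourier projection π_{Zk}f is 2^{-40}-cosine-like. More precisely, writing f_k = |f_k| e^{iθ_k} with θ_k∈[0,2π), one has π_{Zk}f(θ) = 2|f_k|( cos(θ+θ_k) + F^k_*(θ) ) where F^k_*(θ) := (1/(2|f_k|)) Σ_{|j|≥2} f_{jk} e^{ijθ} satisfies Σ_{|j|≥2} |f_{jk}| e^{|j|} / (2|f_k|) ≤ 2^{-40} (so in particular sup_{|Im θ|<1}|F^k_*(θ)| ≤ 2^{-40}). -/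
noncomputable section
open Complex
def norm1 {n : ℕ} (k : Fin n → ℤ) : ℕ := ∑ i, (k i).natAbs
def Zstar (n : ℕ) : Set (Fin n → ℤ) := {k | ∃ j, 0 < k j ∧ ∀ i, i < j → k i = 0}
def gen (n : ℕ) : Set (Fin n → ℤ) :=
  {k | k ∈ Zstar n ∧ Finset.univ.gcd (fun i => (k i).natAbs) = 1}
structure InBall (n : ℕ) (s : ℝ) (c : (Fin n → ℤ) → ℂ) : Prop where
  zero : c 0 = 0
  real : ∀ k, c (-k) = (starRingEnd ℂ) (c k)
  bound : ∀ k, ‖c k‖ * Real.exp (s * norm1 k) ≤ 1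
def Ncut (n : ℕ) (s δ : ℝ) : ℝ :=
  2 * max 1 (1/s * Real.log (2^44 * (2*(n:ℝ) / Real.exp 1)^n / (s^n * δ)))
def P1plus (n : ℕ) (s δ : ℝ) (c : (Fin n → ℤ) → ℂ) : Prop :=
  ∀ k ∈ gen n, Ncut n s δ ≤ (norm1 k : ℝ) →
    δ / (norm1 k : ℝ)^n * Real.exp (-(s * norm1 k)) ≤ ‖c k‖
def projC {n : ℕ} (c : (Fin n → ℤ) → ℂ) (k : Fin n → ℤ) (θ : ℂ) : ℂ :=
  ∑' j : ℤ, if j = 0 then 0 else c (j • k) * Complex.exp (Complex.I * (j : ℂ) * θ)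

/-- `G` is `γ`-cosine-like on the strip of width 2. -/
def CosineLike (γ : ℝ) (G : ℂ → ℂ) : Prop :=
  ∃ η : ℝ, 0 < η ∧ ∃ θ₀ : ℝ, ∀ θ : ℂ, |θ.im| < 1 →
    ‖G θ - (η : ℂ) * Complex.cos (θ + (θ₀ : ℂ))‖ ≤ η * γ

/-- The normalized tail `F^k_*`. -/
def Fstar {n : ℕ} (c : (Fin n → ℤ) → ℂ) (k : Fin n → ℤ) (θ : ℂ) : ℂ :=
  ((1 / (2 * ‖c k‖) : ℝ) : ℂ) *
    ∑' j : ℤ, if 2 ≤ |j| then c (j • k) * Complex.exp (Complex.I * (j : ℂ) * θ) else 0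

theorem norm1_zsmul {n : ℕ} (j : ℤ) (k : Fin n → ℤ) : norm1 (j • k) = j.natAbs * norm1 k := by
  simp [norm1, Finset.mul_sum, Int.natAbs_mul]

theorem natAbs_cast_eq_abs (j : ℤ) : (j.natAbs : ℝ) = |(j : ℝ)| := by
  rw [Nat.cast_natAbs, Int.cast_abs]

/-- The weighted coefficients of the projection onto `ℤk` decay geometrically. -/
theorem InBall.norm_zsmul_mul_exp_le {n : ℕ} {s : ℝ} {c : (Fin n → ℤ) → ℂ} (hc : InBall n s c)
    (k : Fin n → ℤ) (j : ℤ) :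
    ‖c (j • k)‖ * Real.exp |(j : ℝ)| ≤ Real.exp (1 - s * norm1 k) ^ j.natAbs := by
  have h := hc.bound (j • k)
  rw [norm1_zsmul] at h
  have h2 : ‖c (j • k)‖ ≤ Real.exp (-(s * ((j.natAbs * norm1 k : ℕ) : ℝ))) := by
    rw [Real.exp_neg]
    exact (le_inv_mul_iff₀' (Real.exp_pos _)).2 h |>.trans_eq (by simp)
  calc ‖c (j • k)‖ * Real.exp |(j : ℝ)|
      ≤ Real.exp (-(s * ((j.natAbs * norm1 k : ℕ) : ℝ))) * Real.exp |(j : ℝ)| := by gcongr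
    _ = _ := by
      rw [← Real.exp_add, ← Real.exp_nat_mul, ← natAbs_cast_eq_abs]
      congr 1
      push_cast
      ring

theorem hasSum_pow_natAbs_tail {r : ℝ} (hr0 : 0 ≤ r) (hr1 : r < 1) :
    HasSum (fun j : ℤ => if 2 ≤ |j| then r ^ j.natAbs else 0) (2 * (r ^ 2 / (1 - r))) := by
  have hg : HasSum (fun m : ℕ => r ^ (m + 2)) (r ^ 2 / (1 - r)) := by
    have := (hasSum_geometric_of_lt_one hr0 hr1).mul_left (r ^ 2)
    simpa [pow_add, mul_comm, div_eq_mul_inv] using this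
  rw [two_mul]
  apply HasSum.of_nat_of_neg_add_one
  · rw [← hasSum_nat_add_iff' 2]
    simp only [Finset.sum_range_succ, Finset.sum_range_zero]
    convert hg using 1
    · rfl
    · funext m
      rw [if_pos (by push_cast; rw [abs_of_nonneg] <;> omega), Int.natAbs_natCast]
    · simp
  · rw [← hasSum_nat_add_iff' 1]
    simp only [Finset.sum_range_succ, Finset.sum_range_zero]
    convert hg using 1
    · rfl
    · funext m
      rw [if_pos (by push_cast; rw [abs_of_nonpos] <;> omega)]
      congr 1
    · simp

theorem mul_pow_le_exp_half {n : ℕ} (hn : 1 ≤ n) {x : ℝ} (hx : 0 ≤ x) :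
    (x / (2 * n)) ^ n * Real.exp 1 ^ n ≤ Real.exp (x / 2) := by
  have hn' : (0 : ℝ) < n := by exact_mod_cast hn
  rw [← mul_pow]
  calc (x / (2 * n) * Real.exp 1) ^ n
      ≤ (Real.exp (x / (2 * n) - 1) * Real.exp 1) ^ n := by
        gcongr
        linarith [Real.add_one_le_exp (x / (2 * n) - 1)]
    _ = Real.exp (x / 2) := by
        rw [← Real.exp_add, ← Real.exp_nat_mul]
        congr 1
        field_simp
        ring

/-- Above the cutoff, `|k|₁ⁿ e^{-s|k|₁}` is at most `2⁻⁴⁴ δ`. -/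
theorem two_pow_mul_le_of_Ncut_le {n : ℕ} (hn : 1 ≤ n) {s δ K : ℝ} (hs : 0 < s) (hδ : 0 < δ)
    (hK : Ncut n s δ ≤ K) : 2 ^ 44 * K ^ n ≤ δ * Real.exp (s * K) := by
  have hn' : (0 : ℝ) < n := by exact_mod_cast hn
  have he := Real.exp_pos 1
  unfold Ncut at hK
  set A : ℝ := 2 ^ 44 * (2 * (n : ℝ) / Real.exp 1) ^ n / (s ^ n * δ) with hA
  have hA0 : 0 < A := by positivity
  have h1 := le_max_left 1 (1 / s * Real.log A)
  have h2 := le_max_right 1 (1 / s * Real.log A)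
  have hK0 : 0 < K := by linarith
  have hlog : Real.log A ≤ s * K / 2 := by
    have : s * (1 / s * Real.log A) ≤ s * (K / 2) := by gcongr; linarith
    rw [← mul_assoc, mul_one_div_cancel hs.ne', one_mul] at this
    linarith
  have hAE : A ≤ Real.exp (s * K / 2) := (Real.log_le_iff_le_exp hA0).1 hlog
  have hKE := mul_pow_le_exp_half hn (mul_pos hs hK0).le
  have hprod := mul_le_mul hAE hKE (by positivity) (Real.exp_pos _).le
  rw [← Real.exp_add, add_halves] at hprod
  have heq : A * ((s * K / (2 * n)) ^ n * Real.exp 1 ^ n) = 2 ^ 44 * K ^ n / δ := by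
    rw [hA]
    simp only [div_pow, mul_pow]
    field_simp
  rw [heq, div_le_iff₀ hδ] at hprod
  linarith

theorem exists_arg_mem_Ico (z : ℂ) : ∃ t ∈ Set.Ico (0 : ℝ) (2 * Real.pi),
    z = (‖z‖ : ℂ) * Complex.exp (Complex.I * (t : ℂ)) := by
  have hz : z = (‖z‖ : ℂ) * Complex.exp (Complex.I * (Complex.arg z : ℂ)) := by
    rw [mul_comm Complex.I, Complex.norm_mul_exp_arg_mul_I]
  rcases le_or_gt 0 (Complex.arg z) with h | h
  · exact ⟨_, ⟨h, by linarith [Complex.arg_le_pi z, Real.pi_pos]⟩, hz⟩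
  · refine ⟨Complex.arg z + 2 * Real.pi,
      ⟨by linarith [Complex.neg_pi_lt_arg z, Real.pi_pos], by linarith⟩, ?_⟩
    have : Complex.I * ((Complex.arg z + 2 * Real.pi : ℝ) : ℂ) =
        Complex.I * (Complex.arg z : ℂ) + 2 * Real.pi * Complex.I := by push_cast; ring
    rw [this, Complex.exp_periodic]
    exact hz

theorem norm_exp_I_mul_le {θ : ℂ} (hθ : |θ.im| ≤ 1) (j : ℤ) :
    ‖Complex.exp (Complex.I * (j : ℂ) * θ)‖ ≤ Real.exp |(j : ℝ)| := by
  rw [Complex.norm_exp, Real.exp_le_exp]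
  have : (Complex.I * (j : ℂ) * θ).re = -(j * θ.im) := by simp
  rw [this]
  calc -(j * θ.im) ≤ |(j : ℝ) * θ.im| := neg_le_abs _
    _ = |(j : ℝ)| * |θ.im| := abs_mul _ _
    _ ≤ |(j : ℝ)| * 1 := by gcongr
    _ = _ := mul_one _

theorem norm_tail_term_le {n : ℕ} (c : (Fin n → ℤ) → ℂ) (k : Fin n → ℤ) {θ : ℂ}
    (hθ : |θ.im| ≤ 1) (j : ℤ) :
    ‖if 2 ≤ |j| then c (j • k) * Complex.exp (Complex.I * (j : ℂ) * θ) else 0‖ ≤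
      if 2 ≤ |j| then ‖c (j • k)‖ * Real.exp |(j : ℝ)| else 0 := by
  split_ifs
  · rw [norm_mul]
    gcongr
    exact norm_exp_I_mul_le hθ j
  · simp

/-- The projection splits into its first harmonic and the tail over `|j| ≥ 2`. -/
theorem projC_eq_add_tsum {n : ℕ} (c : (Fin n → ℤ) → ℂ) (k : Fin n → ℤ) (θ : ℂ)
    (hsum : Summable fun j : ℤ =>
      if 2 ≤ |j| then c (j • k) * Complex.exp (Complex.I * (j : ℂ) * θ) else 0) :
    projC c k θ = c k * Complex.exp (Complex.I * θ) + c (-k) * Complex.exp (-(Complex.I * θ)) +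
      ∑' j : ℤ, if 2 ≤ |j| then c (j • k) * Complex.exp (Complex.I * (j : ℂ) * θ) else 0 := by
  have h := ((hasSum_ite_eq (1 : ℤ) (c k * Complex.exp (Complex.I * θ))).add
    (hasSum_ite_eq (-1 : ℤ) (c (-k) * Complex.exp (-(Complex.I * θ))))).add hsum.hasSum
  rw [← h.tsum_eq, projC]
  congr 1
  funext j
  by_cases h0 : j = 0
  · simp [h0]
  by_cases h1 : j = 1
  · simp [h1]
  by_cases h2 : j = -1
  · simp [h2]
  have h3 : 2 ≤ |j| := by
    rcases abs_cases j with h | h <;> omega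
  simp [h0, h1, h2, h3]

theorem stmt_0 (n : ℕ) (hn : 1 ≤ n) (s δ : ℝ) (hs : 0 < s) (hδ : 0 < δ) (hδ1 : δ ≤ 1)
    (c : (Fin n → ℤ) → ℂ) (hc : InBall n s c) (hP : P1plus n s δ c) :
    ∀ k ∈ gen n, Ncut n s δ ≤ (norm1 k : ℝ) →
      CosineLike (2 ^ (-40 : ℤ)) (projC c k) ∧
      ∃ θk ∈ Set.Ico (0:ℝ) (2 * Real.pi),
        c k = (‖c k‖ : ℂ) * Complex.exp (Complex.I * (θk : ℂ)) ∧
        (∑' j : ℤ, if 2 ≤ |j| then ‖c (j • k)‖ * Real.exp |(j : ℝ)| else 0) / (2 * ‖c k‖)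
          ≤ 2 ^ (-40 : ℤ) ∧
        (∀ θ : ℂ, |θ.im| < 1 →
          projC c k θ = 2 * (‖c k‖ : ℂ) * (Complex.cos (θ + (θk : ℂ)) + Fstar c k θ)) ∧
        (∀ θ : ℂ, |θ.im| < 1 → ‖Fstar c k θ‖ ≤ 2 ^ (-40 : ℤ)) := by
  intro k hk hN
  have hkey := two_pow_mul_le_of_Ncut_le hn hs hδ hN
  have hlow := hP k hk hN
  have hK1 : (1 : ℝ) ≤ norm1 k := by
    have := le_max_left 1
      (1/s * Real.log (2^44 * (2*(n:ℝ) / Real.exp 1)^n / (s^n * δ)))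
    unfold Ncut at hN
    linarith
  set K : ℝ := (norm1 k : ℝ) with hKdef
  have hKn : 1 ≤ K ^ n := one_le_pow₀ hK1
  set X : ℝ := Real.exp (-(s * K)) with hX
  have hX0 : 0 < X := Real.exp_pos _
  have hEX : Real.exp (s * K) * X = 1 := by rw [hX, ← Real.exp_add]; simp
  have hkX : 2 ^ 44 * K ^ n * X ≤ δ := by
    have := mul_le_mul_of_nonneg_right hkey hX0.le
    rwa [mul_assoc δ, hEX, mul_one] at this
  have hck : 0 < ‖c k‖ := lt_of_lt_of_le (by positivity) hlow
  have hX2 : 2 ^ 44 * X ^ 2 ≤ ‖c k‖ := by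
    refine le_trans ?_ hlow
    rw [div_mul_eq_mul_div, le_div_iff₀ (by positivity)]
    calc 2 ^ 44 * X ^ 2 * K ^ n = (2 ^ 44 * K ^ n * X) * X := by ring
      _ ≤ δ * X := by gcongr
  have hXs : 2 ^ 44 * X ≤ 1 := by nlinarith
  set r : ℝ := Real.exp (1 - s * K) with hr
  have hrX : r = Real.exp 1 * X := by rw [hr, hX, ← Real.exp_add]; ring_nf
  have he := Real.exp_one_lt_d9
  have he0 := Real.exp_pos 1
  have hr0 : 0 ≤ r := (Real.exp_pos _).le
  have hr2 : r ≤ 1 / 2 := by rw [hrX]; nlinarith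
  have hrsq : r ^ 2 ≤ 8 * X ^ 2 := by
    rw [hrX, mul_pow]
    gcongr
    nlinarith
  have hT := hasSum_pow_natAbs_tail hr0 (by linarith : r < 1)
  have hle : ∀ j : ℤ, (if 2 ≤ |j| then ‖c (j • k)‖ * Real.exp |(j : ℝ)| else 0) ≤
      if 2 ≤ |j| then r ^ j.natAbs else 0 := by
    intro j
    split_ifs
    · exact hc.norm_zsmul_mul_exp_le k j
    · exact le_rfl
  have hS : Summable fun j : ℤ => if 2 ≤ |j| then ‖c (j • k)‖ * Real.exp |(j : ℝ)| else 0 :=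
    hT.summable.of_nonneg_of_le (fun j => by split_ifs <;> positivity) hle
  have htail : (∑' j : ℤ, if 2 ≤ |j| then ‖c (j • k)‖ * Real.exp |(j : ℝ)| else 0) / (2 * ‖c k‖)
      ≤ 2 ^ (-40 : ℤ) := by
    rw [div_le_iff₀ (by positivity)]
    refine (hS.tsum_le_tsum hle hT.summable).trans ?_
    rw [hT.tsum_eq]
    have : r ^ 2 / (1 - r) ≤ 16 * X ^ 2 := by
      rw [div_le_iff₀ (by linarith)]
      nlinarith [sq_nonneg X]
    norm_num at hX2 ⊢
    linarith
  have hSθ : ∀ θ : ℂ, |θ.im| < 1 → Summable fun j : ℤ =>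
      if 2 ≤ |j| then c (j • k) * Complex.exp (Complex.I * (j : ℂ) * θ) else 0 :=
    fun θ hθ => Summable.of_norm_bounded hS (norm_tail_term_le c k hθ.le)
  have hF : ∀ θ : ℂ, |θ.im| < 1 → ‖Fstar c k θ‖ ≤ 2 ^ (-40 : ℤ) := by
    intro θ hθ
    refine le_trans ?_ htail
    rw [Fstar, norm_mul, Complex.norm_real, Real.norm_of_nonneg (by positivity),
      one_div_mul_eq_div]
    gcongr
    exact tsum_of_norm_bounded hS.hasSum (norm_tail_term_le c k hθ.le)
  obtain ⟨t, ht, hct⟩ := exists_arg_mem_Ico (c k)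
  have hproj : ∀ θ : ℂ, |θ.im| < 1 →
      projC c k θ = 2 * (‖c k‖ : ℂ) * (Complex.cos (θ + (t : ℂ)) + Fstar c k θ) := by
    intro θ hθ
    have hck' : (‖c k‖ : ℂ) ≠ 0 := by exact_mod_cast hck.ne'
    have hconj : c (-k) = (‖c k‖ : ℂ) * Complex.exp (-(Complex.I * (t : ℂ))) := by
      rw [hc.real]
      conv_lhs => rw [hct]
      rw [map_mul, Complex.conj_ofReal, ← Complex.exp_conj]
      simp
    have h1 : c k * Complex.exp (Complex.I * θ) =
        ‖c k‖ * Complex.exp ((θ + t) * Complex.I) := by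
      conv_lhs => rw [hct]
      rw [mul_assoc, ← Complex.exp_add]
      ring_nf
    have h2 : c (-k) * Complex.exp (-(Complex.I * θ)) =
        ‖c k‖ * Complex.exp (-(θ + t) * Complex.I) := by
      rw [hconj, mul_assoc, ← Complex.exp_add]
      ring_nf
    rw [projC_eq_add_tsum c k θ (hSθ θ hθ), h1, h2, Fstar, Complex.cos]
    push_cast
    field_simp
  refine ⟨⟨2 * ‖c k‖, by positivity, t, fun θ hθ => ?_⟩, t, ht, hct, htail, hproj, hF⟩
  have : projC c k θ - ((2 * ‖c k‖ : ℝ) : ℂ) * Complex.cos (θ + (t : ℂ)) =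
      ((2 * ‖c k‖ : ℝ) : ℂ) * Fstar c k θ := by
    rw [hproj θ hθ]
    push_cast
    ring
  rw [this, norm_mul, Complex.norm_real, Real.norm_of_nonneg (by positivity)]
  gcongr
  exact hF θ hθ
end
end

section
/- Let F∈C²(T,R), θ̄∈R, and 0<c<1/2 be such that ‖F − cos(·+θ̄)‖_{C²} ≤ c, where ‖F‖_{C²} := max_{0≤k≤2} sup_T |F^{(k)}|. Then F has exactly two critical points on T and F is (1−2c)-Morse. -/
/-- `F` is a `β`-Morse function on the torus `ℝ/2πℤ`:
`|F'| + |F''| ≥ β` everywhere, and critical values at critical points which are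
distinct on the torus differ by at least `β`. -/
def BetaMorse (β : ℝ) (F : ℝ → ℝ) : Prop :=
  (∀ θ : ℝ, β ≤ |deriv F θ| + |deriv (deriv F) θ|) ∧
  (∀ θ₁ θ₂ : ℝ, deriv F θ₁ = 0 → deriv F θ₂ = 0 →
    (¬ ∃ m : ℤ, θ₁ - θ₂ = 2 * Real.pi * m) → β ≤ |F θ₁ - F θ₂|)

/-- Every real is congruent mod `2π` to a point of `(-π, π]`. -/
lemma exists_int_sub_mem_Ioc (x : ℝ) :
    ∃ m : ℤ, x - m * (2 * Real.pi) ∈ Set.Ioc (-Real.pi) Real.pi := by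
  obtain ⟨m, hm, -⟩ := existsUnique_sub_zsmul_mem_Ioc Real.two_pi_pos x (-Real.pi)
  refine ⟨m, ?_⟩
  have h : -Real.pi + 2 * Real.pi = Real.pi := by ring
  rwa [zsmul_eq_mul, h] at hm

lemma abs_lt_pi_div_three_of_half_lt_cos {y : ℝ} (hy : y ∈ Set.Ioc (-Real.pi) Real.pi)
    (h : 1 / 2 < Real.cos y) : |y| < Real.pi / 3 := by
  by_contra! h'
  have h1 := Real.cos_le_cos_of_nonneg_of_le_pi (by positivity) (abs_le.2 ⟨hy.1.le, hy.2⟩) h'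
  rw [Real.cos_abs, Real.cos_pi_div_three] at h1
  linarith

/-- At a zero of a function within `c < 1/2` of `-sin (· + b)`, the cosine is large. -/
lemma three_quarters_lt_cos_sq {g : ℝ → ℝ} {b c θ : ℝ} (hc : c < 1 / 2)
    (hg : |g θ + Real.sin (θ + b)| ≤ c) (h0 : g θ = 0) :
    3 / 4 < Real.cos (θ + b) ^ 2 := by
  rw [h0, zero_add] at hg
  have := abs_le.1 hg
  nlinarith [Real.sin_sq_add_cos_sq (θ + b)]

lemma zeros_congruent_of_cos_pos {g : ℝ → ℝ} {b c : ℝ} (hc : c < 1 / 2)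
    (hper : Function.Periodic g (2 * Real.pi)) (hd : Differentiable ℝ g)
    (hg : ∀ θ, |g θ + Real.sin (θ + b)| ≤ c)
    (hg' : ∀ θ, |deriv g θ + Real.cos (θ + b)| ≤ c) {θ₁ θ₂ : ℝ}
    (h₁ : g θ₁ = 0) (h₂ : g θ₂ = 0)
    (hc₁ : 0 < Real.cos (θ₁ + b)) (hc₂ : 0 < Real.cos (θ₂ + b)) :
    ∃ m : ℤ, θ₁ - θ₂ = 2 * Real.pi * m := by
  have key : ∀ θ, g θ = 0 → 0 < Real.cos (θ + b) →
      ∃ m : ℤ, ∃ y ∈ Set.Icc (-b - Real.pi / 3) (-b + Real.pi / 3),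
        g y = 0 ∧ θ = y + m * (2 * Real.pi) := by
    intro θ h0 hpos
    obtain ⟨m, hm⟩ := exists_int_sub_mem_Ioc (θ + b)
    have hsq := three_quarters_lt_cos_sq hc (hg θ) h0
    have hhalf : 1 / 2 < Real.cos (θ + b - m * (2 * Real.pi)) := by
      rw [Real.cos_sub_int_mul_two_pi]
      nlinarith
    have habs := abs_lt.1 (abs_lt_pi_div_three_of_half_lt_cos hm hhalf)
    refine ⟨m, θ - m * (2 * Real.pi), ⟨by linarith, by linarith⟩, ?_, by ring⟩
    rw [hper.sub_int_mul_eq, h0]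
  have hanti : StrictAntiOn g (Set.Icc (-b - Real.pi / 3) (-b + Real.pi / 3)) := by
    refine strictAntiOn_of_deriv_neg (convex_Icc _ _) hd.continuous.continuousOn ?_
    intro x hx
    rw [interior_Icc] at hx
    have hcos : 1 / 2 ≤ Real.cos (x + b) := by
      rw [← Real.cos_abs, ← Real.cos_pi_div_three]
      exact Real.cos_le_cos_of_nonneg_of_le_pi (abs_nonneg _) (by linarith [Real.pi_pos])
        (abs_le.2 ⟨by linarith [hx.1], by linarith [hx.2]⟩)
    linarith [(abs_le.1 (hg' x)).2]
  obtain ⟨m₁, y₁, hy₁, hz₁, e₁⟩ := key θ₁ h₁ hc₁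
  obtain ⟨m₂, y₂, hy₂, hz₂, e₂⟩ := key θ₂ h₂ hc₂
  have hy : y₁ = y₂ := hanti.injOn hy₁ hy₂ (hz₁.trans hz₂.symm)
  refine ⟨m₁ - m₂, ?_⟩
  rw [e₁, e₂, hy]
  push_cast
  ring

lemma exists_zero_cos_pos {g : ℝ → ℝ} {b c : ℝ} (hc : c < 1 / 2)
    (hper : Function.Periodic g (2 * Real.pi)) (hd : Continuous g)
    (hg : ∀ θ, |g θ + Real.sin (θ + b)| ≤ c) :
    ∃ θ ∈ Set.Ico 0 (2 * Real.pi), g θ = 0 ∧ 0 < Real.cos (θ + b) := by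
  have hl : 0 < g (-b - Real.pi / 2) := by
    have h := hg (-b - Real.pi / 2)
    rw [show -b - Real.pi / 2 + b = -(Real.pi / 2) by ring, Real.sin_neg,
      Real.sin_pi_div_two] at h
    linarith [(abs_le.1 h).1]
  have hr : g (-b + Real.pi / 2) < 0 := by
    have h := hg (-b + Real.pi / 2)
    rw [show -b + Real.pi / 2 + b = Real.pi / 2 by ring, Real.sin_pi_div_two] at h
    linarith [(abs_le.1 h).2]
  obtain ⟨x, hx, hx0⟩ := intermediate_value_Ioo' (by linarith [Real.pi_pos]) hd.continuousOn
    (show (0 : ℝ) ∈ Set.Ioo (g (-b + Real.pi / 2)) (g (-b - Real.pi / 2)) from ⟨hr, hl⟩)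
  obtain ⟨m, hm, -⟩ := existsUnique_sub_zsmul_mem_Ico Real.two_pi_pos x 0
  rw [zsmul_eq_mul, zero_add] at hm
  refine ⟨x - m * (2 * Real.pi), hm, by rw [hper.sub_int_mul_eq, hx0], ?_⟩
  rw [show x - m * (2 * Real.pi) + b = x + b - m * (2 * Real.pi) by ring,
    Real.cos_sub_int_mul_two_pi]
  exact Real.cos_pos_of_mem_Ioo ⟨by linarith [hx.1], by linarith [hx.2]⟩

lemma eq_of_sub_eq_two_pi_mul {θ₁ θ₂ : ℝ} (h₁ : θ₁ ∈ Set.Ico 0 (2 * Real.pi))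
    (h₂ : θ₂ ∈ Set.Ico 0 (2 * Real.pi)) (h : ∃ m : ℤ, θ₁ - θ₂ = 2 * Real.pi * m) :
    θ₁ = θ₂ := by
  obtain ⟨m, hm⟩ := h
  have hp := Real.two_pi_pos
  have hlt : (m : ℝ) < 1 := by
    by_contra! h'
    nlinarith [h₁.2, h₂.1]
  have hgt : (-1 : ℝ) < m := by
    by_contra! h'
    nlinarith [h₁.1, h₂.2]
  have hm0 : m = 0 := by
    have h1 : m < 1 := by exact_mod_cast hlt
    have h2 : -1 < m := by exact_mod_cast hgt
    omega
  rw [hm0] at hm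
  push_cast at hm
  linarith

lemma one_le_abs_sin_add_abs_cos (x : ℝ) : 1 ≤ |Real.sin x| + |Real.cos x| := by
  nlinarith [abs_nonneg (Real.sin x), abs_nonneg (Real.cos x), Real.sin_sq_add_cos_sq x,
    sq_abs (Real.sin x), sq_abs (Real.cos x), Real.abs_sin_le_one x, Real.abs_cos_le_one x]

theorem stmt_1 (F : ℝ → ℝ) (hper : Function.Periodic F (2 * Real.pi))
    (hF : ContDiff ℝ 2 F) (θbar c : ℝ) (hc0 : 0 < c) (hc : c < 1/2)
    (hC2 : ∀ θ : ℝ,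
      |F θ - Real.cos (θ + θbar)| ≤ c ∧
      |deriv F θ - (-Real.sin (θ + θbar))| ≤ c ∧
      |deriv (deriv F) θ - (-Real.cos (θ + θbar))| ≤ c) :
    BetaMorse (1 - 2 * c) F ∧
    ∃ θ₁ ∈ Set.Ico (0 : ℝ) (2 * Real.pi), ∃ θ₂ ∈ Set.Ico (0 : ℝ) (2 * Real.pi),
      θ₁ ≠ θ₂ ∧ deriv F θ₁ = 0 ∧ deriv F θ₂ = 0 ∧
      ∀ θ ∈ Set.Ico (0 : ℝ) (2 * Real.pi), deriv F θ = 0 → θ = θ₁ ∨ θ = θ₂ := by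
  have hd : Differentiable ℝ (deriv F) :=
    (contDiff_succ_iff_deriv.1 (show ContDiff ℝ (1 + 1) F by simpa [one_add_one_eq_two] using hF)
      ).2.2.differentiable (by norm_num)
  have hperd : Function.Periodic (deriv F) (2 * Real.pi) := by
    intro x
    rw [← deriv_comp_add_const, show (fun y => F (y + 2 * Real.pi)) = F from funext hper]
  have hg : ∀ θ, |deriv F θ + Real.sin (θ + θbar)| ≤ c := fun θ => by
    simpa only [sub_neg_eq_add] using (hC2 θ).2.1
  have hg' : ∀ θ, |deriv (deriv F) θ + Real.cos (θ + θbar)| ≤ c := fun θ => by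
    simpa only [sub_neg_eq_add] using (hC2 θ).2.2
  have hpern : Function.Periodic (-deriv F) (2 * Real.pi) := fun x => by
    simp only [Pi.neg_apply, hperd x]
  have hgn : ∀ θ, |(-deriv F) θ + Real.sin (θ + (θbar + Real.pi))| ≤ c := fun θ => by
    rw [← add_assoc, Real.sin_add_pi, Pi.neg_apply, ← neg_add, abs_neg]
    exact hg θ
  have hgn' : ∀ θ, |deriv (-deriv F) θ + Real.cos (θ + (θbar + Real.pi))| ≤ c := fun θ => by
    rw [← add_assoc, Real.cos_add_pi, deriv.neg, ← neg_add, abs_neg]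
    exact hg' θ
  have hsame_pos : ∀ θ₁ θ₂, deriv F θ₁ = 0 → deriv F θ₂ = 0 → 0 < Real.cos (θ₁ + θbar) →
      0 < Real.cos (θ₂ + θbar) → ∃ m : ℤ, θ₁ - θ₂ = 2 * Real.pi * m :=
    fun _ _ => zeros_congruent_of_cos_pos hc hperd hd hg hg'
  have hsame_neg : ∀ θ₁ θ₂, deriv F θ₁ = 0 → deriv F θ₂ = 0 → Real.cos (θ₁ + θbar) < 0 →
      Real.cos (θ₂ + θbar) < 0 → ∃ m : ℤ, θ₁ - θ₂ = 2 * Real.pi * m := by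
    intro θ₁ θ₂ h₁ h₂ hc₁ hc₂
    refine zeros_congruent_of_cos_pos hc hpern hd.neg hgn hgn' (by simp [h₁]) (by simp [h₂]) ?_ ?_
    · rw [← add_assoc, Real.cos_add_pi]; linarith
    · rw [← add_assoc, Real.cos_add_pi]; linarith
  have hcos : ∀ θ, deriv F θ = 0 → 3 / 4 < Real.cos (θ + θbar) ^ 2 :=
    fun θ h => three_quarters_lt_cos_sq hc (hg θ) h
  have hgap : ∀ θ₁ θ₂, deriv F θ₁ = 0 → deriv F θ₂ = 0 → 0 < Real.cos (θ₁ + θbar) →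
      Real.cos (θ₂ + θbar) < 0 → 1 - 2 * c ≤ F θ₁ - F θ₂ := by
    intro θ₁ θ₂ h₁ h₂ hc₁ hc₂
    have hhalf₁ : 1 / 2 < Real.cos (θ₁ + θbar) := by nlinarith [hcos θ₁ h₁]
    have hhalf₂ : Real.cos (θ₂ + θbar) < -(1 / 2) := by nlinarith [hcos θ₂ h₂]
    linarith [(abs_le.1 (hC2 θ₁).1).1, (abs_le.1 (hC2 θ₂).1).2]
  have hne : ∀ θ, deriv F θ = 0 → Real.cos (θ + θbar) < 0 ∨ 0 < Real.cos (θ + θbar) := by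
    intro θ h
    refine lt_or_gt_of_ne fun h0 => ?_
    have := hcos θ h
    rw [h0] at this
    norm_num at this
  refine ⟨⟨fun θ => ?_, fun θ₁ θ₂ h₁ h₂ hm => ?_⟩, ?_⟩
  · have hs := abs_sub_abs_le_abs_sub (Real.sin (θ + θbar)) (-deriv F θ)
    have hk := abs_sub_abs_le_abs_sub (Real.cos (θ + θbar)) (-deriv (deriv F) θ)
    rw [abs_neg, sub_neg_eq_add, add_comm (Real.sin _)] at hs
    rw [abs_neg, sub_neg_eq_add, add_comm (Real.cos _)] at hk
    linarith [hg θ, hg' θ, one_le_abs_sin_add_abs_cos (θ + θbar)]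
  · rcases hne θ₁ h₁ with hc₁ | hc₁ <;> rcases hne θ₂ h₂ with hc₂ | hc₂
    · exact absurd (hsame_neg θ₁ θ₂ h₁ h₂ hc₁ hc₂) hm
    · rw [abs_sub_comm]
      exact (hgap θ₂ θ₁ h₂ h₁ hc₂ hc₁).trans (le_abs_self _)
    · exact (hgap θ₁ θ₂ h₁ h₂ hc₁ hc₂).trans (le_abs_self _)
    · exact absurd (hsame_pos θ₁ θ₂ h₁ h₂ hc₁ hc₂) hm
  · obtain ⟨θ₁, hθ₁, h₁, hc₁⟩ := exists_zero_cos_pos hc hperd hd.continuous hg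
    obtain ⟨θ₂, hθ₂, h₂, hc₂⟩ := exists_zero_cos_pos hc hpern hd.neg.continuous hgn
    rw [← add_assoc, Real.cos_add_pi, neg_pos] at hc₂
    rw [Pi.neg_apply, neg_eq_zero] at h₂
    refine ⟨θ₁, hθ₁, θ₂, hθ₂, ?_, h₁, h₂, fun θ hθ h => ?_⟩
    · rintro rfl
      exact lt_asymm hc₁ hc₂
    · rcases hne θ h with hs | hs
      · exact Or.inr (eq_of_sub_eq_two_pi_mul hθ hθ₂ (hsame_neg θ θ₂ h h₂ hs hc₂))
      · exact Or.inl (eq_of_sub_eq_two_pi_mul hθ hθ₁ (hsame_pos θ θ₁ h h₁ hs hc₁))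
end

section
/- Let s>0, n≥1, 0<δ≤1, and let f∈B^n_s satisfy condition (P1+) with parameter δ. Then for every k∈G^n with |k|_1 ≥ N(δ), the Fourier projection π_{Zk}f is |f_k|-Morse. -/
noncomputable section
open Complex

/-- Real restriction of the Fourier projection `π_{ℤk} f`. -/
def projR {n : ℕ} (c : (Fin n → ℤ) → ℂ) (k : Fin n → ℤ) (θ : ℝ) : ℝ :=
  (projC c k (θ : ℂ)).re

theorem abs_sin_sub_sin_ge {x y d : ℝ} {m : ℤ} (hd : x - y = d + m * (2 * Real.pi))
    (hdpi : |d| ≤ Real.pi) (hsx : |Real.sin x| ≤ 1 / 8) (hsy : |Real.sin y| ≤ 1 / 8)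
    (hc : 0 ≤ Real.cos x * Real.cos y) :
    |d| / Real.pi ≤ |Real.sin x - Real.sin y| := by
  have hx : x = y + d + m * (2 * Real.pi) := by linarith
  have hsin : Real.sin x = Real.sin (y + d) := by
    rw [hx, Real.sin_add_int_mul_two_pi]
  have hcos : Real.cos x = Real.cos (y + d) := by
    rw [hx, Real.cos_add_int_mul_two_pi]
  rw [hcos] at hc
  rw [hsin] at hsx ⊢
  have hpi := Real.pi_pos
  have h1 : 2 / Real.pi * |d / 2| ≤ |Real.sin (d / 2)| := by
    apply Real.mul_abs_le_abs_sin
    rw [abs_div, abs_two]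
    linarith
  have h1' : 2 / Real.pi * |d / 2| = |d| / Real.pi := by
    rw [abs_div, abs_two]
    field_simp
  rw [h1'] at h1
  have hss : |Real.sin (y + d) * Real.sin y| ≤ 1 / 8 * (1 / 8) := by
    rw [abs_mul]
    gcongr
  have h2 : 1 / 2 ≤ |Real.cos ((y + d + y) / 2)| := by
    have h3 := Real.cos_sq ((y + d + y) / 2)
    have h4 := Real.cos_add (y + d) y
    have h5 := (abs_le.mp hss).2
    rw [show 2 * ((y + d + y) / 2) = y + d + y by ring] at h3
    have h6 : (1 / 2 : ℝ) ^ 2 ≤ Real.cos ((y + d + y) / 2) ^ 2 := by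
      rw [h3, h4]
      linarith
    have h7 := sq_le_sq.mp h6
    rwa [abs_of_pos (by norm_num : (0 : ℝ) < 1 / 2)] at h7
  rw [Real.sin_sub_sin, show (y + d - y) / 2 = d / 2 by ring, abs_mul, abs_mul, abs_two]
  nlinarith [abs_nonneg (Real.sin (d / 2))]

theorem one_le_abs_cos_sub_cos {x y : ℝ} (hsx : |Real.sin x| ≤ 1 / 8)
    (hsy : |Real.sin y| ≤ 1 / 8) (hc : Real.cos x * Real.cos y ≤ 0) :
    1 ≤ |Real.cos x - Real.cos y| := by
  have h1 : Real.sin x ^ 2 ≤ (1 / 8) ^ 2 := sq_le_sq.mpr (by rwa [abs_of_pos (by norm_num : (0 : ℝ) < 1 / 8)])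
  have h2 : Real.sin y ^ 2 ≤ (1 / 8) ^ 2 := sq_le_sq.mpr (by rwa [abs_of_pos (by norm_num : (0 : ℝ) < 1 / 8)])
  have h3 : (1 : ℝ) ^ 2 ≤ (Real.cos x - Real.cos y) ^ 2 := by
    nlinarith [Real.sin_sq_add_cos_sq x, Real.sin_sq_add_cos_sq y]
  simpa using sq_le_sq.mp h3

/-- A perturbation of `2 A cos (θ + φ)` that is small in `C²` is `A`-Morse. -/
theorem betaMorse_two_mul_cos_add {A φ : ℝ} (hA : 0 < A) {r₀ r₁ r₂ : ℝ → ℝ}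
    (hd₀ : ∀ θ, HasDerivAt r₀ (r₁ θ) θ) (hd₁ : ∀ θ, HasDerivAt r₁ (r₂ θ) θ)
    (hb₀ : ∀ θ, |r₀ θ| ≤ A / 4) (hb₁ : ∀ θ, |r₁ θ| ≤ A / 4) (hb₂ : ∀ θ, |r₂ θ| ≤ A / 4)
    (hper : Function.Periodic r₁ (2 * Real.pi)) :
    BetaMorse A (fun θ => 2 * A * Real.cos (θ + φ) + r₀ θ) := by
  have hD₁ : deriv (fun θ => 2 * A * Real.cos (θ + φ) + r₀ θ) =
      fun θ => -(2 * A * Real.sin (θ + φ)) + r₁ θ := by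
    funext θ
    refine HasDerivAt.deriv ?_
    have h := ((((hasDerivAt_id θ).add_const φ).cos).const_mul (2 * A)).add (hd₀ θ)
    refine h.congr_deriv ?_
    simp
  have hD₂ : deriv (fun θ => -(2 * A * Real.sin (θ + φ)) + r₁ θ) =
      fun θ => -(2 * A * Real.cos (θ + φ)) + r₂ θ := by
    funext θ
    refine HasDerivAt.deriv ?_
    have h := ((((hasDerivAt_id θ).add_const φ).sin).const_mul (2 * A)).neg.add (hd₁ θ)
    refine h.congr_deriv ?_
    simp
  unfold BetaMorse
  rw [hD₁, hD₂]
  refine ⟨fun θ => ?_, fun θ₁ θ₂ h₁ h₂ hne => ?_⟩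
  · have h1 : 1 ≤ |Real.sin (θ + φ)| + |Real.cos (θ + φ)| := by
      have h2 := Real.sin_sq_add_cos_sq (θ + φ)
      rw [← sq_abs (Real.sin _), ← sq_abs (Real.cos _)] at h2
      nlinarith [abs_nonneg (Real.sin (θ + φ)), abs_nonneg (Real.cos (θ + φ))]
    have h3 : |2 * A * Real.sin (θ + φ)| - |r₁ θ| ≤ |-(2 * A * Real.sin (θ + φ)) + r₁ θ| := by
      rw [neg_add_eq_sub, abs_sub_comm]
      exact abs_sub_abs_le_abs_sub _ _
    have h4 : |2 * A * Real.cos (θ + φ)| - |r₂ θ| ≤ |-(2 * A * Real.cos (θ + φ)) + r₂ θ| := by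
      rw [neg_add_eq_sub, abs_sub_comm]
      exact abs_sub_abs_le_abs_sub _ _
    rw [abs_mul, abs_of_pos (by positivity : 0 < 2 * A)] at h3 h4
    nlinarith [hb₁ θ, hb₂ θ]
  · have hsin : ∀ θ, -(2 * A * Real.sin (θ + φ)) + r₁ θ = 0 → |Real.sin (θ + φ)| ≤ 1 / 8 := by
      intro θ h
      have h5 : r₁ θ = 2 * A * Real.sin (θ + φ) := by linarith
      have h6 := hb₁ θ
      rw [h5, abs_mul, abs_of_pos (by positivity : 0 < 2 * A)] at h6
      nlinarith
    have hs₁ := hsin θ₁ h₁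
    have hs₂ := hsin θ₂ h₂
    rcases le_total 0 (Real.cos (θ₁ + φ) * Real.cos (θ₂ + φ)) with hc | hc
    · exfalso
      have hpi := Real.pi_pos
      set m : ℤ := round ((θ₁ - θ₂) / (2 * Real.pi)) with hm
      set d : ℝ := θ₁ - θ₂ - m * (2 * Real.pi) with hd
      have hdpi : |d| ≤ Real.pi := by
        have h7 := abs_sub_round ((θ₁ - θ₂) / (2 * Real.pi))
        have h8 : d = ((θ₁ - θ₂) / (2 * Real.pi) - m) * (2 * Real.pi) := by
          rw [hd]
          field_simp
        rw [h8, abs_mul, abs_of_pos (by positivity : 0 < 2 * Real.pi)]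
        nlinarith
      have hge := abs_sin_sub_sin_ge (x := θ₁ + φ) (y := θ₂ + φ) (d := d) (m := m)
        (by rw [hd]; ring) hdpi hs₁ hs₂ hc
      have hr : r₁ θ₁ = r₁ (θ₂ + d) := by
        have h9 : θ₁ = θ₂ + d + m * (2 * Real.pi) := by rw [hd]; ring
        rw [h9]
        exact hper.int_mul m _
      have hmv : |r₁ θ₁ - r₁ θ₂| ≤ A / 4 * |d| := by
        have h10 := convex_univ.norm_image_sub_le_of_norm_hasDerivWithin_le
          (f := r₁) (f' := r₂) (C := A / 4) (x := θ₂) (y := θ₂ + d)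
          (fun x _ => (hd₁ x).hasDerivWithinAt) (fun x _ => hb₂ x) (Set.mem_univ _) (Set.mem_univ _)
        rw [hr]
        simpa using h10
      have heq : r₁ θ₁ - r₁ θ₂ = 2 * A * (Real.sin (θ₁ + φ) - Real.sin (θ₂ + φ)) := by linarith
      rw [heq, abs_mul, abs_of_pos (by positivity : 0 < 2 * A)] at hmv
      have h11 : 2 * A * (|d| / Real.pi) ≤ A / 4 * |d| :=
        (mul_le_mul_of_nonneg_left hge (by positivity)).trans hmv
      have hd0 : d = 0 := by
        by_contra hdne
        have h12 : 0 < |d| := abs_pos.mpr hdne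
        have h13 : |d| / 4 ≤ |d| / Real.pi := by
          gcongr
          exact Real.pi_le_four
        nlinarith [mul_le_mul_of_nonneg_left h13 hA.le, mul_pos hA h12]
      exact hne ⟨m, by linarith⟩
    · have h14 := one_le_abs_cos_sub_cos hs₁ hs₂ hc
      have h15 : |2 * A * (Real.cos (θ₁ + φ) - Real.cos (θ₂ + φ))| - |r₀ θ₂ - r₀ θ₁| ≤
          |2 * A * Real.cos (θ₁ + φ) + r₀ θ₁ - (2 * A * Real.cos (θ₂ + φ) + r₀ θ₂)| := by
        refine (abs_sub_abs_le_abs_sub _ _).trans (le_of_eq ?_)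
        congr 1
        ring
      have h16 : |r₀ θ₂ - r₀ θ₁| ≤ A / 4 + A / 4 :=
        (abs_sub _ _).trans (add_le_add (hb₀ θ₂) (hb₀ θ₁))
      rw [abs_mul, abs_of_pos (by positivity : 0 < 2 * A)] at h15
      nlinarith

/-- The formal `m`-th derivative of the real part of `∑ⱼ bⱼ e^{ijθ}`. -/
def fourierDeriv (b : ℤ → ℂ) (m : ℕ) (θ : ℝ) : ℝ :=
  ∑' j : ℤ, (b j * (I * j) ^ m * exp (I * j * θ)).re

theorem norm_exp_I_mul_int_mul (j : ℤ) (θ : ℝ) : ‖exp (I * j * θ)‖ = 1 := by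
  rw [show I * j * θ = ((j * θ : ℝ) : ℂ) * I by push_cast; ring]
  exact norm_exp_ofReal_mul_I _

theorem norm_fourier_term (z : ℂ) (m : ℕ) (j : ℤ) (θ : ℝ) :
    ‖z * (I * j) ^ m * exp (I * j * θ)‖ = ‖z‖ * |(j : ℝ)| ^ m := by
  rw [norm_mul, norm_mul, norm_exp_I_mul_int_mul, norm_pow, norm_mul, norm_I]
  simp

theorem abs_re_fourier_term_le {z : ℂ} {m : ℕ} {j : ℤ} {w : ℝ} (h : ‖z‖ * |(j : ℝ)| ^ m ≤ w)
    (θ : ℝ) : ‖(z * (I * j) ^ m * exp (I * j * θ)).re‖ ≤ w :=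
  (abs_re_le_norm _).trans ((norm_fourier_term z m j θ).le.trans h)

theorem abs_fourierDeriv_le {b : ℤ → ℂ} {m : ℕ} {u : ℤ → ℝ} {S : ℝ} (hu : HasSum u S)
    (hb : ∀ j, ‖b j‖ * |(j : ℝ)| ^ m ≤ u j) (θ : ℝ) : |fourierDeriv b m θ| ≤ S :=
  tsum_of_norm_bounded hu fun j => abs_re_fourier_term_le (hb j) θ

theorem hasDerivAt_fourierDeriv {b : ℤ → ℂ} {m : ℕ} {u : ℤ → ℝ} (hu : Summable u)
    (hb : ∀ j, ‖b j‖ * |(j : ℝ)| ^ m ≤ u j) (hb' : ∀ j, ‖b j‖ * |(j : ℝ)| ^ (m + 1) ≤ u j)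
    (θ : ℝ) : HasDerivAt (fourierDeriv b m) (fourierDeriv b (m + 1) θ) θ := by
  refine hasDerivAt_tsum (y₀ := 0) hu (fun j y => ?_)
    (fun j y => abs_re_fourier_term_le (hb' j) y)
    (Summable.of_norm_bounded hu fun j => abs_re_fourier_term_le (hb j) 0) θ
  refine HasDerivAt.real_of_complex (e := fun w : ℂ => b j * (I * j) ^ m * exp (I * j * w)) ?_
  convert! (((hasDerivAt_id (y : ℂ)).const_mul (I * (j : ℂ))).cexp).const_mul
    (b j * (I * j) ^ m) using 1
  simp only [id, mul_one, pow_succ]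
  ring

theorem fourierDeriv_periodic (b : ℤ → ℂ) (m : ℕ) :
    Function.Periodic (fourierDeriv b m) (2 * Real.pi) := by
  intro θ
  unfold fourierDeriv
  congr 1
  funext j
  rw [show I * (j : ℂ) * ((θ + 2 * Real.pi : ℝ) : ℂ) = I * j * θ + j * (2 * Real.pi * I) by
    push_cast; ring, exp_add, exp_int_mul_two_pi_mul_I, mul_one]

theorem hasSum_quarter_pow_natAbs : HasSum (fun j : ℤ => (1 / 4 : ℝ) ^ j.natAbs) (5 / 3) := by
  have h : HasSum (fun n : ℕ => (1 / 4 : ℝ) ^ n) (4 / 3) := by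
    convert hasSum_geometric_of_lt_one (r := (1 / 4 : ℝ)) (by norm_num) (by norm_num) using 1
    norm_num
  have h' := HasSum.of_nat_of_neg (f := fun j : ℤ => (1 / 4 : ℝ) ^ j.natAbs) (g := 4 / 3)
    (g' := 4 / 3) (by simpa using h) (by simpa using h)
  have h5 : (4 / 3 : ℝ) + 4 / 3 - (1 / 4) ^ Int.natAbs 0 = 5 / 3 := by norm_num
  exact h5 ▸ h'

theorem pow_mul_sq_le {q : ℝ} (hq0 : 0 ≤ q) (hq : q ≤ 1 / 16) {j : ℕ} (hj : 2 ≤ j) :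
    q ^ j * (j : ℝ) ^ 2 ≤ 64 * q ^ 2 * (1 / 4) ^ j := by
  obtain ⟨i, rfl⟩ := Nat.exists_eq_add_of_le hj
  have h1 : (2 + i : ℕ) ≤ 2 * 2 ^ i := by
    induction i with
    | zero => norm_num
    | succ i ih =>
      have := ih (by omega)
      rw [pow_succ]
      omega
  have h2 : ((2 + i : ℕ) : ℝ) ≤ 2 * 2 ^ i := by exact_mod_cast h1
  calc q ^ (2 + i) * ((2 + i : ℕ) : ℝ) ^ 2
      ≤ q ^ 2 * (1 / 16) ^ i * (2 * 2 ^ i) ^ 2 := by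
        rw [pow_add]
        gcongr
    _ = 64 * q ^ 2 * (1 / 4) ^ (2 + i) := by
        have h3 : ((1 : ℝ) / 16) ^ i * (2 ^ i) ^ 2 = (1 / 4) ^ i := by
          rw [← pow_mul, mul_comm i 2, pow_mul, ← mul_pow]
          norm_num
        rw [mul_pow, pow_add, ← h3]
        ring

theorem InBall.norm_zsmul_le {n : ℕ} {s : ℝ} {c : (Fin n → ℤ) → ℂ} (hc : InBall n s c)
    (j : ℤ) (k : Fin n → ℤ) : ‖c (j • k)‖ ≤ Real.exp (-(s * norm1 k)) ^ j.natAbs := by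
  have h := hc.bound (j • k)
  rw [norm1_zsmul, ← le_div_iff₀ (Real.exp_pos _), one_div, ← Real.exp_neg] at h
  rw [← Real.exp_nat_mul]
  rwa [show (j.natAbs : ℝ) * -(s * norm1 k) = -(s * ((j.natAbs * norm1 k : ℕ) : ℝ)) by
    push_cast; ring]

/-- The Fourier modes of `π_{ℤk} f` of order at least two. -/
def higherModes {n : ℕ} (c : (Fin n → ℤ) → ℂ) (k : Fin n → ℤ) (j : ℤ) : ℂ :=
  if 2 ≤ j.natAbs then c (j • k) else 0

theorem higherModes_bound {n : ℕ} {s : ℝ} {c : (Fin n → ℤ) → ℂ} (hc : InBall n s c)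
    {k : Fin n → ℤ} (hq : Real.exp (-(s * norm1 k)) ≤ 1 / 16) {m : ℕ} (hm : m ≤ 2) (j : ℤ) :
    ‖higherModes c k j‖ * |(j : ℝ)| ^ m ≤
      64 * Real.exp (-(s * norm1 k)) ^ 2 * (1 / 4) ^ j.natAbs := by
  unfold higherModes
  split_ifs with hj
  · have habs : |(j : ℝ)| = (j.natAbs : ℝ) := by
      rw [Nat.cast_natAbs, Int.cast_abs]
    have h1 : (1 : ℝ) ≤ j.natAbs := by exact_mod_cast (by omega : 1 ≤ j.natAbs)
    rw [habs]
    refine le_trans ?_ (pow_mul_sq_le (Real.exp_pos _).le hq hj)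
    gcongr
    exact hc.norm_zsmul_le j k
  · simp only [norm_zero, zero_mul]
    positivity

theorem projR_eq {n : ℕ} {s : ℝ} {c : (Fin n → ℤ) → ℂ} (hc : InBall n s c)
    {k : Fin n → ℤ} (hq : Real.exp (-(s * norm1 k)) ≤ 1 / 16) :
    projR c k = fun θ => 2 * ‖c k‖ * Real.cos (θ + (c k).arg) +
      fourierDeriv (higherModes c k) 0 θ := by
  funext θ
  have hre (w : ℂ) (θ : ℝ) : (w * exp (I * θ)).re = ‖w‖ * Real.cos (θ + w.arg) := by
    conv_lhs => rw [← norm_mul_exp_arg_mul_I w]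
    rw [mul_assoc, ← exp_add, show (w.arg : ℂ) * I + I * θ = ((θ + w.arg : ℝ) : ℂ) * I by
      push_cast; ring, re_ofReal_mul, exp_ofReal_mul_I_re]
  have hsum : Summable fun j : ℤ => higherModes c k j * exp (I * j * θ) := by
    refine Summable.of_norm_bounded
      (hasSum_quarter_pow_natAbs.mul_left (64 * Real.exp (-(s * norm1 k)) ^ 2)).summable
      fun j => ?_
    have h := norm_fourier_term (higherModes c k j) 0 j θ
    rw [pow_zero, mul_one] at h
    exact h.le.trans (higherModes_bound hc hq (by norm_num) j)
  have hproj : projC c k θ = c k * exp (I * θ) + c (-k) * exp (-(I * θ)) +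
      ∑' j : ℤ, higherModes c k j * exp (I * j * θ) := by
    have h := ((hasSum_ite_eq (1 : ℤ) (c k * exp (I * θ))).add
      (hasSum_ite_eq (-1 : ℤ) (c (-k) * exp (-(I * θ))))).add hsum.hasSum
    rw [projC, ← h.tsum_eq]
    congr 1
    funext j
    unfold higherModes
    by_cases h0 : j = 0
    · simp [h0]
    by_cases h1 : j = 1
    · simp [h1]
    by_cases h2 : j = -1
    · simp [h2]
    · rw [if_neg h0, if_neg h1, if_neg h2, if_pos (by omega)]
      simp
  have hconj : c (-k) * exp (-(I * θ)) = (starRingEnd ℂ) (c k * exp (I * θ)) := by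
    rw [hc.real, map_mul, ← exp_conj, map_mul, conj_I, conj_ofReal, neg_mul]
  rw [projR, hproj, hconj, add_re, add_re, conj_re, hre, re_tsum hsum]
  unfold fourierDeriv
  simp only [pow_zero, mul_one]
  ring

theorem mul_pow_mul_exp_neg_half_le (n : ℕ) (hn : 1 ≤ n) {x : ℝ} (hx : 0 ≤ x) :
    x ^ n * Real.exp (-(x / 2)) ≤ (2 * (n : ℝ) / Real.exp 1) ^ n := by
  have hn' : (0 : ℝ) < n := by exact_mod_cast hn
  have h1 : x / (2 * n) ≤ Real.exp (x / (2 * n) - 1) := by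
    linarith [Real.add_one_le_exp (x / (2 * n) - 1)]
  have h2 : x ≤ 2 * n / Real.exp 1 * Real.exp (x / (2 * n)) := by
    rw [Real.exp_sub, div_le_iff₀ (by positivity)] at h1
    calc x ≤ _ := h1
      _ = _ := by ring
  calc x ^ n * Real.exp (-(x / 2))
      ≤ (2 * n / Real.exp 1 * Real.exp (x / (2 * n))) ^ n * Real.exp (-(x / 2)) := by gcongr
    _ = (2 * (n : ℝ) / Real.exp 1) ^ n := by
        rw [mul_pow, ← Real.exp_nat_mul, mul_assoc, ← Real.exp_add]
        rw [show (n : ℝ) * (x / (2 * n)) + -(x / 2) = 0 by field_simp; ring]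
        simp

theorem two_le_Ncut (n : ℕ) (s δ : ℝ) : 2 ≤ Ncut n s δ := by
  have h : ∀ x : ℝ, 2 ≤ 2 * max 1 x := fun x => by linarith [le_max_left 1 x]
  exact h _

theorem pow_mul_exp_neg_le_of_Ncut_le {n : ℕ} (hn : 1 ≤ n) {s δ N : ℝ} (hs : 0 < s) (hδ : 0 < δ)
    (hN : Ncut n s δ ≤ N) : 2 ^ 44 * (N ^ n * Real.exp (-(s * N))) ≤ δ := by
  have hn' : (0 : ℝ) < n := by exact_mod_cast hn
  have h2N : 2 ≤ N := (two_le_Ncut n s δ).trans hN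
  have hNpos : 0 < N := by linarith
  set K : ℝ := (2 * (n : ℝ) / Real.exp 1) ^ n with hK
  have hKpos : 0 < K := by positivity
  have hlog : Real.log (2 ^ 44 * K / (s ^ n * δ)) ≤ s * N / 2 := by
    have h1 : 2 * (1 / s * Real.log (2 ^ 44 * K / (s ^ n * δ))) ≤ N :=
      le_trans (by unfold Ncut; gcongr; exact le_max_right _ _) hN
    have h2 := mul_le_mul_of_nonneg_left h1 hs.le
    have h3 : s * (2 * (1 / s * Real.log (2 ^ 44 * K / (s ^ n * δ)))) =
        2 * Real.log (2 ^ 44 * K / (s ^ n * δ)) := by field_simp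
    linarith
  rw [Real.log_le_iff_le_exp (by positivity), div_le_iff₀ (by positivity)] at hlog
  have h4 := mul_pow_mul_exp_neg_half_le n hn (x := s * N) (by positivity)
  rw [← hK, mul_pow] at h4
  have hE : Real.exp (s * N / 2) * Real.exp (-(s * N / 2)) = 1 := by
    rw [← Real.exp_add]; simp
  have hE2 : Real.exp (-(s * N)) = Real.exp (-(s * N / 2)) * Real.exp (-(s * N / 2)) := by
    rw [← Real.exp_add]; ring_nf
  have h5 : s ^ n * (2 ^ 44 * (N ^ n * Real.exp (-(s * N)))) ≤ s ^ n * δ := by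
    calc s ^ n * (2 ^ 44 * (N ^ n * Real.exp (-(s * N))))
        = 2 ^ 44 * (s ^ n * N ^ n * Real.exp (-(s * N / 2))) * Real.exp (-(s * N / 2)) := by
          rw [hE2]; ring
      _ ≤ 2 ^ 44 * K * Real.exp (-(s * N / 2)) := by gcongr
      _ ≤ Real.exp (s * N / 2) * (s ^ n * δ) * Real.exp (-(s * N / 2)) := by gcongr
      _ = s ^ n * δ := by linear_combination s ^ n * δ * hE
  exact le_of_mul_le_mul_left h5 (by positivity)

theorem stmt_2 (n : ℕ) (hn : 1 ≤ n) (s δ : ℝ) (hs : 0 < s) (hδ : 0 < δ) (hδ1 : δ ≤ 1)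
    (c : (Fin n → ℤ) → ℂ) (hc : InBall n s c) (hP : P1plus n s δ c) :
    ∀ k ∈ gen n, Ncut n s δ ≤ (norm1 k : ℝ) →
      BetaMorse ‖c k‖ (projR c k) := by
  intro k hk hN
  have hkey := pow_mul_exp_neg_le_of_Ncut_le hn hs hδ hN
  have hlow := hP k hk hN
  have h2N : (2 : ℝ) ≤ norm1 k := (two_le_Ncut n s δ).trans hN
  set N : ℝ := (norm1 k : ℝ) with hNdef
  have hNpos : 0 < N := by linarith
  set q : ℝ := Real.exp (-(s * N)) with hqdef
  have hq0 : 0 < q := Real.exp_pos _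
  have hNn : 1 ≤ N ^ n := one_le_pow₀ (by linarith)
  have hq : q ≤ 1 / 16 := by nlinarith
  have hA : 0 < ‖c k‖ := lt_of_lt_of_le (by positivity) hlow
  have hqA : 2 ^ 44 * q ^ 2 ≤ ‖c k‖ := by
    refine le_trans ?_ hlow
    have h1 : 2 ^ 44 * q ≤ δ / N ^ n := by
      rw [le_div_iff₀ (by positivity)]
      linarith
    nlinarith
  have hu := hasSum_quarter_pow_natAbs.mul_left (64 * q ^ 2)
  have hS : 64 * q ^ 2 * (5 / 3) ≤ ‖c k‖ / 4 := by nlinarith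
  have hb (m : ℕ) (hm : m ≤ 2) := higherModes_bound hc hq hm
  rw [projR_eq hc hq]
  exact betaMorse_two_mul_cos_add hA
    (hasDerivAt_fourierDeriv hu.summable (hb 0 (by norm_num)) (hb 1 (by norm_num)))
    (hasDerivAt_fourierDeriv hu.summable (hb 1 (by norm_num)) (hb 2 le_rfl))
    (fun θ => (abs_fourierDeriv_le hu (hb 0 (by norm_num)) θ).trans hS)
    (fun θ => (abs_fourierDeriv_le hu (hb 1 (by norm_num)) θ).trans hS)
    (fun θ => (abs_fourierDeriv_le hu (hb 2 le_rfl) θ).trans hS)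
    (fourierDeriv_periodic _ _)

end
end
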